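/- arXiv:2207.09853 — 7 statements merged into one kernel-verified Lean document; each statement's English description precedes it below -/
import Mathlib

section
/- Every valuation v of the given form is submodular: for every set S ⊆ M and every pair of distinct items a, b ∈ M \ S, it holds that v(S ∪ {a}) + v(S ∪ {b}) ≥ v(S ∪ {a, b}) + v(S). -/
/-- The hard submodular valuation from the lower-bound construction is
indeed submodular: for every set `S` and distinct items `a b ∉ S`,
`v(S ∪ {a}) + v(S ∪ {b}) ≥ v(S ∪ {a,b}) + v(S)`. -/
theorem submodularity_of_hard_valuation
    {α : Type*} [Fintype α] [DecidableEq α]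
    (m k : ℕ) (hm4 : 4 ≤ m) (hmeven : Even m) (hcard : Fintype.card α = m)
    (hk : k = m / 2)
    (𝓑 : Finset (Finset α)) (h𝓑 : ∀ B ∈ 𝓑, B.card = k + 1)
    (G : Finset α) (hG : G.card = k) (hGB : ∀ B ∈ 𝓑, ¬ G ⊆ B)
    (v : Finset α → ℝ)
    (hv1 : ∀ S : Finset α, k + 1 < S.card → v S = k)
    (hv2 : ∀ S : Finset α, S.card = k + 1 → S ∈ 𝓑 → v S = k)
    (hv3 : ∀ S : Finset α, S.card = k + 1 → S ∉ 𝓑 → v S = k - 3 / 11)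
    (hv4 : v G = k - 6 / 11)
    (hv5 : ∀ S : Finset α, S.card = k → S ≠ G → v S = k - 7 / 11)
    (hv6 : ∀ S : Finset α, S.card = k - 1 → (∀ B ∈ 𝓑, ¬ S ⊆ B) → v S = k - 1)
    (hv7 : ∀ S : Finset α, S.card = k - 1 → (∃ B ∈ 𝓑, S ⊆ B) → v S = k - 14 / 11)
    (hv8 : ∀ S : Finset α, S.card < k - 1 → v S = S.card) :
    ∀ (S : Finset α) (a b : α), a ∉ S → b ∉ S → a ≠ b →
      v (insert a (insert b S)) + v S ≤ v (insert a S) + v (insert b S) := by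
  intro S a b ha hb hab
  have hk2 : 2 ≤ k := by omega
  have hcb : (insert b S).card = S.card + 1 := Finset.card_insert_of_notMem hb
  have hca : (insert a S).card = S.card + 1 := Finset.card_insert_of_notMem ha
  have hcab : (insert a (insert b S)).card = S.card + 2 := by
    rw [Finset.card_insert_of_notMem (by simp [hab, ha]), hcb]
  have succ_bounds : ∀ T : Finset α, T.card = k + 1 → (k : ℝ) - 3 / 11 ≤ v T ∧ v T ≤ k := by
    intro T hT
    by_cases hTB : T ∈ 𝓑
    · rw [hv2 T hT hTB]; constructor <;> linarith
    · rw [hv3 T hT hTB]; constructor <;> linarith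
  have mid_bounds : ∀ T : Finset α, T.card = k →
      (k : ℝ) - 7 / 11 ≤ v T ∧ v T ≤ k - 6 / 11 := by
    intro T hT
    by_cases hTG : T = G
    · rw [hTG, hv4]; constructor <;> linarith
    · rw [hv5 T hT hTG]; constructor <;> linarith
  have pred_bounds : ∀ T : Finset α, T.card = k - 1 →
      (k : ℝ) - 14 / 11 ≤ v T ∧ v T ≤ k - 1 := by
    intro T hT
    by_cases hTB : ∃ B ∈ 𝓑, T ⊆ B
    · rw [hv7 T hT hTB]; constructor <;> linarith
    · rw [hv6 T hT (by simpa using hTB)]; constructor <;> linarith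
  have hcases : k + 1 < S.card ∨ S.card = k + 1 ∨ S.card = k ∨ S.card + 1 = k ∨
      S.card + 2 = k ∨ S.card + 3 = k ∨ S.card + 3 < k := by omega
  rcases hcases with h | h | h | h | h | h | h
  · rw [hv1 _ (by omega), hv1 S h, hv1 (insert a S) (by omega), hv1 (insert b S) (by omega)]
  · rw [hv1 _ (by omega), hv1 (insert a S) (by omega), hv1 (insert b S) (by omega)]
    linarith [succ_bounds S h]
  · rw [hv1 _ (by omega)]
    linarith [(mid_bounds S h).2, (succ_bounds (insert a S) (by omega)).1,
      (succ_bounds (insert b S) (by omega)).1]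
  · have hma := (mid_bounds (insert a S) (by omega)).1
    have hmb := (mid_bounds (insert b S) (by omega)).1
    by_cases hSB : ∃ B ∈ 𝓑, S ⊆ B
    · rw [hv7 S (by omega) hSB]
      linarith [(succ_bounds (insert a (insert b S)) (by omega)).2]
    · push Not at hSB
      have htop : insert a (insert b S) ∉ 𝓑 := fun hB =>
        hSB _ hB ((Finset.subset_insert b S).trans (Finset.subset_insert a _))
      rw [hv6 S (by omega) hSB, hv3 _ (by omega) htop]
      linarith
  · have hkS : (k : ℝ) = S.card + 2 := by exact_mod_cast h.symm
    rw [hv8 S (by omega)]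
    linarith [(mid_bounds (insert a (insert b S)) (by omega)).2,
      (pred_bounds (insert a S) (by omega)).1, (pred_bounds (insert b S) (by omega)).1]
  · have hkS : (k : ℝ) = S.card + 3 := by exact_mod_cast h.symm
    rw [hv8 S (by omega), hv8 (insert a S) (by omega), hv8 (insert b S) (by omega), hca, hcb]
    push_cast
    linarith [(pred_bounds (insert a (insert b S)) (by omega)).2]
  · rw [hv8 S (by omega), hv8 (insert a S) (by omega), hv8 (insert b S) (by omega),
      hv8 (insert a (insert b S)) (by omega), hca, hcb, hcab]
    push_cast
    linarith
end

section
/- Let m ≥ 2 and let A be an ℓ × m real matrix all of whose entries are 0 or 1, with rank(A) ≤ m − 1. Then there exist two vectors x, y ∈ ℝ^m with strictly positive entries satisfying A·x = A·𝟏 and A·y = A·𝟏 (where 𝟏 is the all-ones vector) such that the set of coordinates at which x attains its minimum value is disjoint from the set of coordinates at which y attains its minimum value; in particular the two solutions disagree on the identity of the items with the smallest value. -/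
/-- A matrix that is not of full column rank has a nonzero vector in its kernel. -/
theorem exists_ne_zero_mulVec_eq_zero_of_rank_lt {ι κ K : Type*} [Fintype κ] [Field K]
    (A : Matrix ι κ K) (h : A.rank < Fintype.card κ) :
    ∃ v : κ → K, v ≠ 0 ∧ A.mulVec v = 0 := by
  by_contra! hA
  have hinj : Function.Injective A.mulVecLin := by
    rw [injective_iff_map_eq_zero]
    intro v hv
    by_contra hne
    exact hA v hne hv
  have hrank := LinearMap.finrank_range_of_inj hinj
  rw [Module.finrank_fintype_fun_eq_card] at hrank
  exact h.ne hrank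

/-- The zero matrix is the only nonnegative matrix annihilating the all-ones vector. -/
theorem eq_zero_of_mulVec_one_eq_zero {ι κ : Type*} [Fintype κ] (A : Matrix ι κ ℝ)
    (hA : ∀ i j, 0 ≤ A i j) (h : A.mulVec 1 = 0) : A = 0 := by
  ext i j
  have hi : ∑ k, A i k = 0 := by simpa [Matrix.mulVec, dotProduct] using congrFun h i
  exact (Finset.sum_eq_zero_iff_of_nonneg fun k _ => hA i k).1 hi j (Finset.mem_univ j)

/-- A nonnegative matrix with at least two columns that is not of full column rank has a
nonconstant vector in its kernel. -/
theorem exists_nonconstant_mulVec_eq_zero {ι κ : Type*} [Fintype κ] [Nontrivial κ]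
    (A : Matrix ι κ ℝ) (hA : ∀ i j, 0 ≤ A i j) (h : A.rank < Fintype.card κ) :
    ∃ v : κ → ℝ, A.mulVec v = 0 ∧ ∃ a b, v a < v b := by
  classical
  obtain ⟨v, hv0, hv⟩ := exists_ne_zero_mulVec_eq_zero_of_rank_lt A h
  by_cases hconst : ∃ a b, v a < v b
  · exact ⟨v, hv, hconst⟩
  push Not at hconst
  obtain ⟨a, b, hab⟩ := exists_pair_ne κ
  have hva : v = v a • (1 : κ → ℝ) := by
    ext j
    simpa using le_antisymm (hconst a j) (hconst j a)
  have hva0 : v a ≠ 0 := fun h0 => hv0 (by rw [hva, h0, zero_smul])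
  have hone : A.mulVec 1 = 0 := by
    rw [hva, Matrix.mulVec_smul] at hv
    exact (smul_eq_zero.1 hv).resolve_left hva0
  refine ⟨Pi.single b 1, ?_, a, b, ?_⟩
  · rw [eq_zero_of_mulVec_one_eq_zero A hA hone, Matrix.zero_mulVec]
  · simp [hab]

/-- For a 0/1 matrix `A` of rank at most `m - 1` (with `m ≥ 2`), the system
`A·x = A·𝟏`, `x > 0` has two solutions whose sets of minimal coordinates are disjoint;
in particular the two solutions disagree on the identity of the items with smallest value. -/
theorem two_solutions_disagree_on_minimum
    (ℓ m : ℕ) (hm : 2 ≤ m)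
    (A : Matrix (Fin ℓ) (Fin m) ℝ)
    (hA01 : ∀ i j, A i j = 0 ∨ A i j = 1)
    (hrank : A.rank ≤ m - 1) :
    ∃ x y : Fin m → ℝ,
      (∀ i, 0 < x i) ∧ (∀ i, 0 < y i) ∧
      A.mulVec x = A.mulVec 1 ∧ A.mulVec y = A.mulVec 1 ∧
      Disjoint {i : Fin m | ∀ j, x i ≤ x j} {i : Fin m | ∀ j, y i ≤ y j} := by
  have : Nontrivial (Fin m) := Fin.nontrivial_iff_two_le.2 hm
  have hnonneg : ∀ i j, 0 ≤ A i j := fun i j => by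
    rcases hA01 i j with h | h <;> simp [h]
  obtain ⟨v, hv, a, b, hab⟩ :=
    exists_nonconstant_mulVec_eq_zero A hnonneg (by rw [Fintype.card_fin]; omega)
  obtain ⟨ε, hε, hbound⟩ : ∃ ε : ℝ, 0 < ε ∧ ∀ i, |ε * v i| < 1 := by
    have hpos : 0 < 1 + ‖v‖ := by positivity
    refine ⟨(1 + ‖v‖)⁻¹, inv_pos.2 hpos, fun i => ?_⟩
    rw [abs_mul, abs_of_pos (inv_pos.2 hpos), inv_mul_lt_one₀ hpos]
    have := norm_le_pi_norm v i
    rw [Real.norm_eq_abs] at this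
    linarith
  refine ⟨1 + ε • v, 1 - ε • v, fun i => ?_, fun i => ?_, ?_, ?_, ?_⟩
  · have := (abs_lt.1 (hbound i)).1
    simp only [Pi.add_apply, Pi.one_apply, Pi.smul_apply, smul_eq_mul]
    linarith
  · have := (abs_lt.1 (hbound i)).2
    simp only [Pi.sub_apply, Pi.one_apply, Pi.smul_apply, smul_eq_mul]
    linarith
  · rw [Matrix.mulVec_add, Matrix.mulVec_smul, hv, smul_zero, add_zero]
  · rw [Matrix.mulVec_sub, Matrix.mulVec_smul, hv, smul_zero, sub_zero]
  · rw [Set.disjoint_left]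
    intro i hx hy
    have hmin := hx a
    have hmax := hy b
    simp only [Pi.add_apply, Pi.sub_apply, Pi.one_apply, Pi.smul_apply, smul_eq_mul,
      add_le_add_iff_left, sub_le_sub_iff_left] at hmin hmax
    exact hab.not_ge (le_of_mul_le_mul_left (hmax.trans hmin) hε)
end

section
/- Let (Q₁, π₁) be a bundle-size pricing menu over m items all of whose positive prices lie in the interval [1, H] for some H ≥ 1, and let 0 < ε < 1. Then there exists a bundle-size pricing menu (Q₂, π₂) over m items that offers at most 2 + (5/ε²)·ln H different bundle sizes such that for every monotone valuation v : 2^M → ℝ≥0 with v(∅) = 0, every demanded choice (q, S) of v in (Q₁, π₁) and every demanded choice (q′, S′) of v in (Q₂, π₂) satisfy π₂(q′) ≥ (1 − ε)·π₁(q). Moreover, if H > 2, the menu (Q₂, π₂) can be chosen so that in addition the ratio of any two distinct positive prices in π₂ is at least e^{ε²/7}. -/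
/-- A bundle-size pricing menu over `m` items: a set `Q` of sizes containing `0`,
all sizes at most `m`, with nonnegative prices `π`, `π 0 = 0`, strictly increasing on `Q`. -/
def IsBSPMenu (m : ℕ) (Q : Finset ℕ) (π : ℕ → ℝ) : Prop :=
  0 ∈ Q ∧ (∀ q ∈ Q, q ≤ m) ∧ π 0 = 0 ∧ (∀ q ∈ Q, 0 ≤ π q) ∧
    (∀ q ∈ Q, ∀ q' ∈ Q, q < q' → π q < π q')

/-- A buyer with valuation `v` demands `(q, S)` in the menu `(Q, π)` if `q ∈ Q`,
`|S| = q`, and `(q, S)` maximizes profit `v(S) - π(q)` over all such pairs. -/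
def Demands {α : Type*} [Fintype α] [DecidableEq α] (v : Finset α → ℝ)
    (Q : Finset ℕ) (π : ℕ → ℝ) (q : ℕ) (S : Finset α) : Prop :=
  q ∈ Q ∧ S.card = q ∧
    ∀ q' ∈ Q, ∀ S' : Finset α, S'.card = q' → v S' - π q' ≤ v S - π q

/-- The index of the geometric level `[exp (a * k), exp (a * (k + 1)))` containing `x ≥ 1`. -/
noncomputable def priceLevel (a x : ℝ) : ℕ := ⌊Real.log x / a⌋₊

theorem exp_priceLevel_le {a x : ℝ} (ha : 0 < a) (hx : 1 ≤ x) :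
    Real.exp (a * priceLevel a x) ≤ x := by
  rw [← Real.le_log_iff_exp_le (by linarith)]
  have h := Nat.floor_le (div_nonneg (Real.log_nonneg hx) ha.le)
  rw [le_div_iff₀ ha] at h
  rw [mul_comm]
  exact h

theorem le_exp_mul_exp_priceLevel {a x : ℝ} (ha : 0 < a) (hx : 1 ≤ x) :
    x ≤ Real.exp a * Real.exp (a * priceLevel a x) := by
  rw [← Real.exp_add, ← Real.log_le_iff_le_exp (by linarith)]
  have h := (Nat.lt_floor_add_one (Real.log x / a)).le
  rw [div_le_iff₀ ha] at h
  change _ ≤ ((priceLevel a x : ℝ) + 1) * a at h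
  linarith

theorem priceLevel_mono {a x y : ℝ} (ha : 0 < a) (hx : 0 < x) (hxy : x ≤ y) :
    priceLevel a x ≤ priceLevel a y :=
  Nat.floor_le_floor (div_le_div_of_nonneg_right (Real.log_le_log hx hxy) ha.le)

theorem one_sub_mul_exp_sub_one_le {ε : ℝ} (h0 : 0 < ε) (h1 : ε < 1) :
    (1 - ε) * (Real.exp (ε ^ 2 / 5) - 1) ≤ ε ^ 2 / 4 := by
  have h := Real.add_one_le_exp (-(ε ^ 2 / 5))
  rw [Real.exp_neg] at h
  have hE := Real.exp_pos (ε ^ 2 / 5)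
  set E := Real.exp (ε ^ 2 / 5)
  have h2 : (-(ε ^ 2 / 5) + 1) * E ≤ 1 := by
    simpa [hE.ne'] using mul_le_mul_of_nonneg_right h hE.le
  have hpos : 0 < 5 - ε ^ 2 := by nlinarith
  have h3 : (E - 1) * (5 - ε ^ 2) ≤ ε ^ 2 := by nlinarith
  have h4 : (1 - ε) * ((E - 1) * (5 - ε ^ 2)) ≤ (1 - ε) * ε ^ 2 :=
    mul_le_mul_of_nonneg_left h3 (by linarith)
  have h5 : (1 - ε) * ε ^ 2 ≤ ε ^ 2 / 4 * (5 - ε ^ 2) := by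
    have : 0 ≤ ε ^ 2 * (1 + 4 * ε - ε ^ 2) := mul_nonneg (sq_nonneg ε) (by nlinarith)
    nlinarith
  refine le_of_mul_le_mul_right ?_ hpos
  linarith

/-- Rounding a price `p` down to `r` and discounting by `ε / 2` loses at most an `ε` fraction when
the buyer switches to an option whose price drops by at least as much. -/
theorem one_sub_mul_le_of_discount_le {ε E p r p' r' : ℝ} (h0 : 0 < ε) (h1 : ε < 1)
    (hE : (1 - ε) * (E - 1) ≤ ε ^ 2 / 4) (hr : r ≤ p) (hr' : 0 ≤ r') (hp' : p' ≤ E * r')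
    (h : p - (1 - ε / 2) * r ≤ p' - (1 - ε / 2) * r') :
    (1 - ε) * p ≤ (1 - ε / 2) * r' := by
  have h2 : ε / 2 * p ≤ (E - 1 + ε / 2) * r' := by nlinarith
  have h3 := mul_le_mul_of_nonneg_left h2 (sub_nonneg.2 h1.le)
  have h4 := mul_le_mul_of_nonneg_right hE hr'
  refine le_of_mul_le_mul_left ?_ (half_pos h0)
  nlinarith

/-- Any bundle-size pricing menu whose positive prices lie in `[1, H]` can be
replaced by a bundle-size pricing menu offering at most `2 + (5/ε²)·ln H` different
(nonzero) bundle sizes, losing at most an `ε` fraction of the payment of every monotone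
valuation; moreover for `H > 2` the ratio of any two distinct positive prices in the new
menu is at least `e^{ε²/7}`. -/
theorem bsp_menu_log_levels
    {α : Type*} [Fintype α] [DecidableEq α] (m : ℕ) (hcard : Fintype.card α = m)
    (H : ℝ) (hH : 1 ≤ H) (ε : ℝ) (hε0 : 0 < ε) (hε1 : ε < 1)
    (Q₁ : Finset ℕ) (π₁ : ℕ → ℝ) (hM1 : IsBSPMenu m Q₁ π₁)
    (hprices : ∀ q ∈ Q₁, 0 < π₁ q → 1 ≤ π₁ q ∧ π₁ q ≤ H) :
    ∃ (Q₂ : Finset ℕ) (π₂ : ℕ → ℝ), IsBSPMenu m Q₂ π₂ ∧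
      ((Q₂.erase 0).card : ℝ) ≤ 2 + (5 / ε ^ 2) * Real.log H ∧
      (∀ v : Finset α → ℝ, (∀ S, 0 ≤ v S) → v ∅ = 0 →
        (∀ S T : Finset α, S ⊆ T → v S ≤ v T) →
        ∀ q S, Demands v Q₁ π₁ q S → ∀ q' S', Demands v Q₂ π₂ q' S' →
          (1 - ε) * π₁ q ≤ π₂ q') ∧
      (2 < H → ∀ q ∈ Q₂, ∀ q' ∈ Q₂, 0 < π₂ q → π₂ q < π₂ q' →
        Real.exp (ε ^ 2 / 7) ≤ π₂ q' / π₂ q) := by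
  classical
  obtain ⟨h0Q, hQm, hπ0, hπnn, hπlt⟩ := hM1
  have ha : 0 < ε ^ 2 / 5 := by positivity
  set a := ε ^ 2 / 5 with ha_def
  have hpos : ∀ q ∈ Q₁, q ≠ 0 → 0 < π₁ q := fun q hq hq0 => by
    simpa [hπ0] using hπlt 0 h0Q q hq (Nat.pos_of_ne_zero hq0)
  have hone : ∀ q ∈ Q₁, q ≠ 0 → 1 ≤ π₁ q := fun q hq hq0 => (hprices q hq (hpos q hq hq0)).1
  let k : ℕ → ℕ := fun q => priceLevel a (π₁ q)
  have hkmono : ∀ q ∈ Q₁, q ≠ 0 → ∀ q' ∈ Q₁, q ≤ q' → k q ≤ k q' := by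
    intro q hq hq0 q' hq' hle
    refine priceLevel_mono ha (hpos q hq hq0) ?_
    rcases hle.eq_or_lt with rfl | hlt
    · exact le_rfl
    · exact (hπlt q hq q' hq' hlt).le
  let Q₂ : Finset ℕ := Q₁.filter fun q => q = 0 ∨ ∀ q' ∈ Q₁, q < q' → k q < k q'
  let π₂ : ℕ → ℝ := fun q => if q = 0 then 0 else (1 - ε / 2) * Real.exp (a * k q)
  have hπ₂ : ∀ q, q ≠ 0 → π₂ q = (1 - ε / 2) * Real.exp (a * k q) := fun q hq => if_neg hq
  have hπ₂0 : π₂ 0 = 0 := if_pos rfl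
  have hc : 0 < 1 - ε / 2 := by linarith
  have hπ₂pos : ∀ q, q ≠ 0 → 0 < π₂ q := fun q hq => by
    rw [hπ₂ q hq]
    positivity
  have hsub : ∀ q ∈ Q₂, q ∈ Q₁ := fun q hq => (Finset.mem_filter.1 hq).1
  have hklt : ∀ q ∈ Q₂, q ≠ 0 → ∀ q' ∈ Q₂, q < q' → k q < k q' := fun q hq hq0 q' hq' hlt =>
    (Finset.mem_filter.1 hq).2.resolve_left hq0 q' (hsub q' hq') hlt
  have hrep : ∀ q ∈ Q₁, ∃ q' ∈ Q₂, q ≤ q' ∧ π₂ q' = π₂ q := by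
    intro q hq
    by_cases hq0 : q = 0
    · exact ⟨q, Finset.mem_filter.2 ⟨hq, Or.inl hq0⟩, le_rfl, rfl⟩
    obtain ⟨t, ht, hmax⟩ := Finset.exists_max_image
      (Q₁.filter fun q' => q ≤ q' ∧ k q' = k q) id ⟨q, by simp [hq]⟩
    obtain ⟨htQ, hqt, htk⟩ := Finset.mem_filter.1 ht
    have ht0 : t ≠ 0 := by omega
    refine ⟨t, Finset.mem_filter.2 ⟨htQ, Or.inr fun u hu htu => ?_⟩, hqt, ?_⟩
    · refine lt_of_le_of_ne (hkmono t htQ ht0 u hu htu.le) fun heq => ?_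
      have : u ≤ t := hmax u (Finset.mem_filter.2 ⟨hu, by omega, heq.symm.trans htk⟩)
      omega
    · rw [hπ₂ t ht0, hπ₂ q hq0, htk]
  refine ⟨Q₂, π₂, ⟨Finset.mem_filter.2 ⟨h0Q, Or.inl rfl⟩, fun q hq => hQm q (hsub q hq), hπ₂0,
    fun q _ => ?_, fun q hq q' hq' hlt => ?_⟩, ?_, ?_, ?_⟩
  · by_cases hq0 : q = 0
    · rw [hq0, hπ₂0]
    · exact (hπ₂pos q hq0).le
  · have hq'0 : q' ≠ 0 := by omega
    by_cases hq0 : q = 0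
    · rw [hq0, hπ₂0]
      exact hπ₂pos q' hq'0
    · rw [hπ₂ q hq0, hπ₂ q' hq'0]
      have : (k q : ℝ) < k q' := by exact_mod_cast hklt q hq hq0 q' hq' hlt
      gcongr
  · have hcard_le : (Q₂.erase 0).card ≤ (Finset.range (priceLevel a H + 1)).card := by
      refine Finset.card_le_card_of_injOn k (fun q hq => ?_) fun q hq q' hq' heq => ?_
      · obtain ⟨hq0, hq⟩ := Finset.mem_erase.1 hq
        have hqp := hpos q (hsub q hq) hq0
        exact Finset.mem_coe.2 (Finset.mem_range.2 (Nat.lt_succ_of_le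
          (priceLevel_mono ha hqp (hprices q (hsub q hq) hqp).2)))
      · obtain ⟨hq0, hq⟩ := Finset.mem_erase.1 hq
        obtain ⟨hq'0, hq'⟩ := Finset.mem_erase.1 hq'
        rcases lt_trichotomy q q' with hlt | rfl | hlt
        · exact absurd heq (hklt q hq hq0 q' hq' hlt).ne
        · rfl
        · exact absurd heq (hklt q' hq' hq'0 q hq hlt).ne'
    rw [Finset.card_range] at hcard_le
    have hcast : ((Q₂.erase 0).card : ℝ) ≤ priceLevel a H + 1 := by exact_mod_cast hcard_le
    have hfloor : (priceLevel a H : ℝ) ≤ Real.log H / a :=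
      Nat.floor_le (div_nonneg (Real.log_nonneg hH) ha.le)
    have hdiv : Real.log H / a = 5 / ε ^ 2 * Real.log H := by
      rw [ha_def]
      field_simp
    linarith
  · intro v _ _ hmono q S ⟨hq, hS, hopt⟩ q' S' ⟨hq', hS', hopt'⟩
    by_cases hq0 : q = 0
    · rw [hq0, hπ0, mul_zero]
      by_cases hq'0 : q' = 0
      · rw [hq'0, hπ₂0]
      · exact (hπ₂pos q' hq'0).le
    obtain ⟨t, ht, hqt, hπt⟩ := hrep q hq
    obtain ⟨T, hST, hT⟩ := Finset.exists_superset_card_eq (s := S) (n := t) (by omega)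
      (by have := hQm t (hsub t ht); omega)
    have hvT := hmono S T hST
    have hswitch := hopt' t ht T hT
    have horig := hopt q' (hsub q' hq') S' hS'
    have hdrop : π₁ q - π₂ q ≤ π₁ q' - π₂ q' := by linarith
    have hle := exp_priceLevel_le ha (hone q hq hq0)
    have hp := hpos q hq hq0
    rw [hπ₂ q hq0] at hdrop
    by_cases hq'0 : q' = 0
    · rw [hq'0, hπ0, hπ₂0] at hdrop
      have hdisc : (1 - ε / 2) * Real.exp (a * k q) ≤ (1 - ε / 2) * π₁ q :=
        mul_le_mul_of_nonneg_left hle hc.le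
      have := mul_pos hε0 hp
      linarith
    · rw [hπ₂ q' hq'0] at hdrop ⊢
      exact one_sub_mul_le_of_discount_le hε0 hε1 (one_sub_mul_exp_sub_one_le hε0 hε1) hle
        (Real.exp_pos _).le (le_exp_mul_exp_priceLevel ha (hone q' (hsub q' hq') hq'0)) hdrop
  · intro _ q hq q' hq' hqpos hlt
    have hq0 : q ≠ 0 := by
      rintro rfl
      exact hqpos.ne' hπ₂0
    have hq'0 : q' ≠ 0 := by
      rintro rfl
      linarith
    rw [hπ₂ q hq0, hπ₂ q' hq'0] at *
    have hexp := Real.exp_lt_exp.1 (lt_of_mul_lt_mul_left hlt hc.le)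
    have hk : k q + 1 ≤ k q' := by exact_mod_cast lt_of_mul_lt_mul_left hexp ha.le
    have hk' : (k q : ℝ) + 1 ≤ k q' := by exact_mod_cast hk
    rw [mul_div_mul_left _ _ hc.ne', ← Real.exp_sub]
    refine Real.exp_le_exp.2 ?_
    have := mul_le_mul_of_nonneg_left hk' ha.le
    have : ε ^ 2 / 7 ≤ a := by
      rw [ha_def]
      gcongr
      norm_num
    linarith
end

section
/- Let 0 < ε < 1 and let s, s′ > 0 be reals. Suppose φ(s) and φ(s′) are reals satisfying (1 − ε/2)·s ≤ φ(s) ≤ (1 − ε/2)(1 + ε²/4)·s and (1 − ε/2)·s′ ≤ φ(s′) ≤ (1 − ε/2)(1 + ε²/4)·s′. If (1 − ε/2 + ε²/4)·s > s′, then φ(s) − φ(s′) < s − s′. -/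
/-- The key rounding inequality. If `φ(s)` and `φ(s')` are roundings of the
prices `s, s'` satisfying `(1 - ε/2)s ≤ φ(s) ≤ (1 - ε/2)(1 + ε²/4)s` (and similarly for
`s'`), and `(1 - ε/2 + ε²/4)s > s'`, then `φ(s) - φ(s') < s - s'`. -/
theorem rounding_inequality
    (ε s s' φs φs' : ℝ) (hε0 : 0 < ε) (hε1 : ε < 1)
    (hs : 0 < s) (hs' : 0 < s')
    (h1 : (1 - ε / 2) * s ≤ φs) (h2 : φs ≤ (1 - ε / 2) * (1 + ε ^ 2 / 4) * s)
    (h3 : (1 - ε / 2) * s' ≤ φs') (h4 : φs' ≤ (1 - ε / 2) * (1 + ε ^ 2 / 4) * s')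
    (h5 : (1 - ε / 2 + ε ^ 2 / 4) * s > s') :
    φs - φs' < s - s' := by
  have key := mul_lt_mul_of_pos_left h5 (half_pos hε0)
  linarith
end

section
/- Assume 𝓑 and 𝓡 are nonempty, and let p : M → ℝ≥0 be a price vector, extended to sets by p(S) = Σ_{i∈S} p(i). Suppose that every set U ⊆ M maximizing v(U) − p(U) over all subsets of M has size exactly k. Then every such maximizer U of size k satisfies at least one of the following: (a) p(U) ≤ p(S) for every S ⊆ M with |S| = k; or (b) there exists i ∈ U such that p(U \ {i}) < p(R′) for every R′ ∈ 𝓡; or (c) there exists i ∈ M \ U such that p(U ∪ {i}) < p(B′) for every B′ ∈ 𝓑. -/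
/-- A finite set all of whose weights are at most `c`, while all weights outside it are at
least `c`, has the least total weight among the sets of its cardinality. -/
theorem Finset.sum_le_sum_of_card_eq_of_threshold {α : Type*} [DecidableEq α] {p : α → ℝ}
    {c : ℝ} {U S : Finset α} (hin : ∀ i ∈ U, p i ≤ c) (hout : ∀ i ∉ U, c ≤ p i)
    (hcard : U.card = S.card) : ∑ i ∈ U, p i ≤ ∑ i ∈ S, p i := by
  have h1 : ∑ i ∈ U \ S, p i ≤ (U \ S).card • c :=
    Finset.sum_le_card_nsmul _ _ _ fun i hi => hin i (Finset.mem_sdiff.1 hi).1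
  have h2 : (S \ U).card • c ≤ ∑ i ∈ S \ U, p i :=
    Finset.card_nsmul_le_sum _ _ _ fun i hi => hout i (Finset.mem_sdiff.1 hi).2
  rw [Finset.card_sdiff_comm hcard] at h1
  have h3 := Finset.sum_sdiff_sub_sum_sdiff (s₁ := U) (s₂ := S) (f := p)
  linarith

/-- For the hard submodular valuation, if every profit-maximizing set at price
vector `p` has size exactly `k`, then every such maximizer `U` is either a cheapest set of
size `k`, or some `U \ {i}` is cheaper than every member of `𝓡`, or some `U ∪ {i}` is
cheaper than every member of `𝓑`. -/
theorem demanded_set_of_size_k_characterization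
    {α : Type*} [Fintype α] [DecidableEq α]
    (m k : ℕ) (hm4 : 4 ≤ m) (hmeven : Even m) (hcard : Fintype.card α = m)
    (hk : k = m / 2)
    (𝓑 : Finset (Finset α)) (h𝓑 : ∀ B ∈ 𝓑, B.card = k + 1)
    (G : Finset α) (hG : G.card = k) (hGB : ∀ B ∈ 𝓑, ¬ G ⊆ B)
    (𝓡 : Finset (Finset α))
    (h𝓡 : ∀ S : Finset α, S ∈ 𝓡 ↔ S.card = k - 1 ∧ ∀ B ∈ 𝓑, ¬ S ⊆ B)
    (h𝓑ne : 𝓑.Nonempty) (h𝓡ne : 𝓡.Nonempty)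
    (v : Finset α → ℝ)
    (hv1 : ∀ S : Finset α, k + 1 < S.card → v S = k)
    (hv2 : ∀ S : Finset α, S.card = k + 1 → S ∈ 𝓑 → v S = k)
    (hv3 : ∀ S : Finset α, S.card = k + 1 → S ∉ 𝓑 → v S = k - 3 / 11)
    (hv4 : v G = k - 6 / 11)
    (hv5 : ∀ S : Finset α, S.card = k → S ≠ G → v S = k - 7 / 11)
    (hv6 : ∀ S : Finset α, S ∈ 𝓡 → v S = k - 1)
    (hv7 : ∀ S : Finset α, S.card = k - 1 → S ∉ 𝓡 → v S = k - 14 / 11)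
    (hv8 : ∀ S : Finset α, S.card < k - 1 → v S = S.card)
    (p : α → ℝ) (hp : ∀ i, 0 ≤ p i)
    (hsize : ∀ U : Finset α,
      (∀ T : Finset α, v T - ∑ i ∈ T, p i ≤ v U - ∑ i ∈ U, p i) → U.card = k) :
    ∀ U : Finset α,
      (∀ T : Finset α, v T - ∑ i ∈ T, p i ≤ v U - ∑ i ∈ U, p i) →
      ((∀ S : Finset α, S.card = k → ∑ i ∈ U, p i ≤ ∑ i ∈ S, p i) ∨
        (∃ i ∈ U, ∀ R' ∈ 𝓡, ∑ j ∈ U.erase i, p j < ∑ j ∈ R', p j) ∨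
        (∃ i ∉ U, ∀ B' ∈ 𝓑, ∑ j ∈ insert i U, p j < ∑ j ∈ B', p j)) := by
  intro U hU
  have hUk := hsize U hU
  have hk2 : 2 ≤ k := by omega
  have hstrict : ∀ T : Finset α, T.card ≠ k →
      v T - ∑ i ∈ T, p i < v U - ∑ i ∈ U, p i := by
    intro T hT
    by_contra! h
    exact hT (hsize T fun S => (hU S).trans h)
  by_cases hUG : U = G
  · subst hUG
    by_contra! ⟨⟨S, hS, hlt⟩, hb, hc⟩
    have hin : ∀ i ∈ U, p i ≤ 1 / 2 := by
      intro i hi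
      obtain ⟨R, hR, hle⟩ := hb i hi
      have hRcard := ((h𝓡 R).1 hR).1
      have h1 := hstrict R (by omega)
      rw [hv6 R hR, hv4] at h1
      have h2 := Finset.add_sum_erase U p hi
      linarith
    have hout : ∀ i ∉ U, 1 / 2 ≤ p i := by
      intro i hi
      obtain ⟨B, hB, hle⟩ := hc i hi
      have hBcard := h𝓑 B hB
      have h1 := hstrict B (by omega)
      rw [hv2 B hBcard hB, hv4] at h1
      rw [Finset.sum_insert hi] at hle
      linarith
    have := Finset.sum_le_sum_of_card_eq_of_threshold hin hout (hUk.trans hS.symm)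
    linarith
  · left
    intro S hS
    have h := hU S
    rw [hv5 U hUk hUG] at h
    by_cases hSG : S = G
    · subst hSG
      linarith
    · rw [hv5 S hS hSG] at h
      linarith
end

section
/- Let (M, 𝓘) be a finite matroid on a ground set M of m elements with a weight function ω : M → ℝ≥0, and let v be the associated weighted matroid rank valuation, v(S) = max{Σ_{a∈A} ω(a) : A ⊆ S, A ∈ 𝓘}. Let R ∈ 𝓘 be a maximum-weight independent set, i.e., ω(R) ≥ ω(A) for every A ∈ 𝓘 (where ω(A) = Σ_{a∈A} ω(a)). Then: (i) for every k ≤ |R| there exists S ⊆ R with |S| = k such that v(S) ≥ v(T) for every T ⊆ M with |T| = k (a k-optimal set contained in R); and (ii) for every k with |R| ≤ k ≤ m, every set S with R ⊆ S ⊆ M and |S| = k satisfies v(S) ≥ v(T) for every T ⊆ M with |T| = k. -/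
open Finset in
/-- If `R` has at least as many elements above every threshold as `A`, then `A` is dominated in
weight by a subset of `R` of the same size. -/
theorem exists_subset_card_eq_sum_le_of_threshold {α : Type*} [DecidableEq α] (ω : α → ℝ)
    (A R : Finset α)
    (h : ∀ t : ℝ, (A.filter (t ≤ ω ·)).card ≤ (R.filter (t ≤ ω ·)).card) :
    ∃ S ⊆ R, S.card = A.card ∧ ∑ a ∈ A, ω a ≤ ∑ a ∈ S, ω a := by
  induction hn : A.card generalizing A R with
  | zero =>
    obtain rfl := card_eq_zero.mp hn
    exact ⟨∅, empty_subset _, rfl, le_rfl⟩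
  | succ n ih =>
    obtain ⟨a, ha, hmax⟩ := A.exists_max_image ω (card_pos.mp (by omega))
    have hpos : 0 < (R.filter (ω a ≤ ω ·)).card :=
      (card_pos.mpr ⟨a, mem_filter.mpr ⟨ha, le_refl (ω a)⟩⟩).trans_le (h (ω a))
    obtain ⟨r, hr⟩ := card_pos.mp hpos
    obtain ⟨hrR, har⟩ := mem_filter.mp hr
    obtain ⟨S, hSR, hS, hle⟩ := ih (A.erase a) (R.erase r) (fun t ↦ by
      rcases le_or_gt t (ω a) with ht | ht
      · rw [filter_erase, filter_erase, card_erase_of_mem (mem_filter.mpr ⟨ha, ht⟩),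
          card_erase_of_mem (mem_filter.mpr ⟨hrR, ht.trans har⟩)]
        exact Nat.sub_le_sub_right (h t) 1
      · rw [filter_false_of_mem fun x hx ↦ not_le.mpr ((hmax x (mem_of_mem_erase hx)).trans_lt ht)]
        simp) (by rw [card_erase_of_mem ha, hn]; rfl)
    have hrS : r ∉ S := fun hmem ↦ notMem_erase r R (hSR hmem)
    refine ⟨insert r S, insert_subset hrR (hSR.trans (erase_subset _ _)), ?_, ?_⟩
    · rw [card_insert_of_notMem hrS, hS]
    · rw [sum_insert hrS, ← add_sum_erase A ω ha]
      exact add_le_add har hle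

/-- An independent set extends, using elements of an independent set `R`, to an independent set
at least as large as `R`. -/
theorem exists_indep_extension {α : Type*} [DecidableEq α] (𝓘 : Set (Finset α))
    (hexch : ∀ A ∈ 𝓘, ∀ B ∈ 𝓘, A.card < B.card → ∃ b ∈ B, b ∉ A ∧ insert b A ∈ 𝓘)
    {R : Finset α} (hR : R ∈ 𝓘) (A : Finset α) (hA : A ∈ 𝓘) :
    ∃ B ∈ 𝓘, A ⊆ B ∧ B ⊆ A ∪ R ∧ R.card ≤ B.card := by
  induction hn : R.card - A.card generalizing A with
  | zero => exact ⟨A, hA, subset_rfl, Finset.subset_union_left, by omega⟩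
  | succ n ih =>
    obtain ⟨b, hbR, hbA, hins⟩ := hexch A hA R hR (by omega)
    obtain ⟨B, hB, hAB, hBR, hcard⟩ :=
      ih (insert b A) hins (by rw [Finset.card_insert_of_notMem hbA]; omega)
    refine ⟨B, hB, (Finset.subset_insert _ _).trans hAB, hBR.trans ?_, hcard⟩
    grind

open Finset in
/-- A maximum-weight independent set has, above every positive threshold, at least as many
elements as any other independent set. -/
theorem card_filter_le_of_max_weight {α : Type*} [DecidableEq α] (𝓘 : Set (Finset α))
    (hdown : ∀ A ∈ 𝓘, ∀ B ⊆ A, B ∈ 𝓘)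
    (hexch : ∀ A ∈ 𝓘, ∀ B ∈ 𝓘, A.card < B.card → ∃ b ∈ B, b ∉ A ∧ insert b A ∈ 𝓘)
    (ω : α → ℝ) {R : Finset α} (hR : R ∈ 𝓘)
    (hRmax : ∀ A ∈ 𝓘, ∑ a ∈ A, ω a ≤ ∑ a ∈ R, ω a)
    {A : Finset α} (hA : A ∈ 𝓘) {t : ℝ} (ht : 0 < t) :
    (A.filter (t ≤ ω ·)).card ≤ (R.filter (t ≤ ω ·)).card := by
  by_contra! hlt
  obtain ⟨b, hbA, hbR₀, hins⟩ := hexch _ (hdown R hR _ (filter_subset _ _)) _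
    (hdown A hA _ (filter_subset _ _)) hlt
  have htb : t ≤ ω b := (mem_filter.mp hbA).2
  have hbR : b ∉ R := fun hb ↦ hbR₀ (mem_filter.mpr ⟨hb, htb⟩)
  obtain ⟨B, hB, hsub, hBR, hcard⟩ := exists_indep_extension 𝓘 hexch hR _ hins
  have hBins : B ⊆ insert b R := hBR.trans (by grind)
  have hdiff : (insert b R \ B).card ≤ 1 := by
    rw [card_sdiff_of_subset hBins, card_insert_of_notMem hbR]
    omega
  have hsum := sum_sdiff (f := ω) hBins
  rw [sum_insert hbR] at hsum
  have hlight : ∑ a ∈ insert b R \ B, ω a < ω b := by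
    rcases (insert b R \ B).eq_empty_or_nonempty with h | hne
    · rw [h, sum_empty]
      exact ht.trans_le htb
    · obtain ⟨c, h⟩ := card_eq_one.mp (hdiff.antisymm hne.card_pos)
      rw [h, sum_singleton]
      have hmem : c ∈ insert b R \ B := h ▸ mem_singleton_self c
      by_contra! hbc
      have : t ≤ ω c := htb.trans hbc
      grind
  linarith [hRmax B hB]


/-- For a weighted matroid rank valuation with a maximum-weight independent
set `R`: (i) for every `k ≤ |R|` there is a `k`-optimal set contained in `R`; and (ii)
for every `|R| ≤ k ≤ m`, every set of size `k` containing `R` is `k`-optimal. -/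
theorem weighted_matroid_rank_k_optimal
    {α : Type*} [Fintype α] [DecidableEq α]
    (𝓘 : Set (Finset α)) (hne : 𝓘.Nonempty)
    (hdown : ∀ A ∈ 𝓘, ∀ B ⊆ A, B ∈ 𝓘)
    (hexch : ∀ A ∈ 𝓘, ∀ B ∈ 𝓘, A.card < B.card → ∃ b ∈ B, b ∉ A ∧ insert b A ∈ 𝓘)
    (ω : α → ℝ) (hω : ∀ a : α, 0 ≤ ω a)
    (v : Finset α → ℝ)
    (hv : ∀ S : Finset α,
      IsGreatest {x : ℝ | ∃ A ∈ 𝓘, A ⊆ S ∧ x = ∑ a ∈ A, ω a} (v S))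
    (R : Finset α) (hR : R ∈ 𝓘)
    (hRmax : ∀ A ∈ 𝓘, ∑ a ∈ A, ω a ≤ ∑ a ∈ R, ω a) :
    (∀ k : ℕ, k ≤ R.card →
      ∃ S ⊆ R, S.card = k ∧ ∀ T : Finset α, T.card = k → v T ≤ v S) ∧
    (∀ k : ℕ, R.card ≤ k → k ≤ Fintype.card α →
      ∀ S : Finset α, R ⊆ S → S.card = k →
        ∀ T : Finset α, T.card = k → v T ≤ v S) := by
  have hle : ∀ S ∈ 𝓘, ∑ a ∈ S, ω a ≤ v S := fun S hS ↦ (hv S).2 ⟨S, hS, subset_rfl, rfl⟩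
  refine ⟨fun k hk ↦ ?_, fun k _ _ S hRS _ T _ ↦ ?_⟩
  · obtain ⟨S, hS, hmax⟩ := (R.powersetCard k).exists_max_image (fun S ↦ ∑ a ∈ S, ω a)
      (Finset.powersetCard_nonempty.mpr hk)
    obtain ⟨hSR, hSk⟩ := Finset.mem_powersetCard.mp hS
    refine ⟨S, hSR, hSk, fun T hT ↦ ?_⟩
    obtain ⟨A, hA, hAT, hvT⟩ := (hv T).1
    have hAk : A.card ≤ k := hT ▸ Finset.card_le_card hAT
    obtain ⟨S₁, hS₁R, hS₁, hAS₁⟩ := exists_subset_card_eq_sum_le_of_threshold ω A R fun t ↦ by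
      rcases lt_or_ge 0 t with ht | ht
      · exact card_filter_le_of_max_weight 𝓘 hdown hexch ω hR hRmax hA ht
      · rw [Finset.filter_true_of_mem fun x _ ↦ ht.trans (hω x),
          Finset.filter_true_of_mem fun x _ ↦ ht.trans (hω x)]
        exact hAk.trans hk
    obtain ⟨S₂, hS₁₂, hS₂R, hS₂⟩ :=
      Finset.exists_subsuperset_card_eq hS₁R (hS₁.trans_le hAk) hk
    calc v T = ∑ a ∈ A, ω a := hvT
      _ ≤ ∑ a ∈ S₁, ω a := hAS₁
      _ ≤ ∑ a ∈ S₂, ω a := Finset.sum_le_sum_of_subset_of_nonneg hS₁₂ fun a _ _ ↦ hω a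
      _ ≤ ∑ a ∈ S, ω a := hmax S₂ (Finset.mem_powersetCard.mpr ⟨hS₂R, hS₂⟩)
      _ ≤ v S := hle S (hdown R hR S hSR)
  · obtain ⟨A, hA, -, hvT⟩ := (hv T).1
    rw [hvT]
    exact (hRmax A hA).trans ((hv S).2 ⟨R, hR, hRS, rfl⟩)
end

section
/- Let D be a finitely supported probability distribution over monotone valuations v : 2^M → ℝ≥0 with v(∅) = 0 over a set M of m items, let (Q, π) be a bundle-size pricing menu over m items, and let σ be a selection rule for (Q, π), i.e., for every v in the support of D, σ(v) ∈ Q maximizes (max_{S ⊆ M, |S| = σ(v)... } i.e., max_{|S|=q} v(S)) − π(q) over q ∈ Q. Let Rev = E_{v∼D}[π(σ(v))] and suppose Rev > 0, and let 0 < ε ≤ 1. Then there exists a smallest d ∈ Q with π(d)·Pr_{v∼D}[σ(v) = d] ≥ (ε/m)·Rev; and, setting Q₂ = {q ∈ Q : q ≥ d} ∪ {0} with π₂ the restriction of π to Q₂, there exists a selection rule σ₂ for the bundle-size pricing menu (Q₂, π₂) such that E_{v∼D}[π₂(σ₂(v))] ≥ (1 − ε)·Rev. -/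
/-- If every size in `A ⊆ {1, …, m}` contributes less than `c / m` to the expected revenue,
then the sizes in `A` together contribute less than `c`. -/
theorem sum_revenue_ite_mem_lt {ι : Type*} [Fintype ι] {m : ℕ} (hm : 0 < m)
    (prob : ι → ℝ) (π : ℕ → ℝ) (σ : ι → ℕ) {A : Finset ℕ} (hA : A ⊆ Finset.Icc 1 m)
    {c : ℝ} (hc : 0 < c)
    (h : ∀ q ∈ A, π q * ∑ i ∈ Finset.univ.filter (fun i => σ i = q), prob i < c / m) :
    ∑ i, (if σ i ∈ A then prob i * π (σ i) else 0) < c := by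
  have hfiber : ∑ i, (if σ i ∈ A then prob i * π (σ i) else 0) =
      ∑ q ∈ A, π q * ∑ i ∈ Finset.univ.filter (fun i => σ i = q), prob i := by
    have hq : ∀ q, π q * ∑ i ∈ Finset.univ.filter (fun i => σ i = q), prob i =
        ∑ i, if σ i = q then prob i * π (σ i) else 0 := by
      intro q
      rw [Finset.mul_sum, Finset.sum_filter]
      refine Finset.sum_congr rfl fun i _ => ?_
      split_ifs with hi
      · rw [hi, mul_comm]
      · rfl
    simp_rw [hq]
    rw [Finset.sum_comm]
    refine Finset.sum_congr rfl fun i _ => ?_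
    rw [Finset.sum_ite_eq]
  rw [hfiber]
  have hm' : (0 : ℝ) < m := by exact_mod_cast hm
  rcases A.eq_empty_or_nonempty with rfl | hne
  · simpa using hc
  · have hcard : (A.card : ℝ) ≤ m := by
      have := Finset.card_le_card hA
      rw [Nat.card_Icc, Nat.add_sub_cancel] at this
      exact_mod_cast this
    calc _ < ∑ _q ∈ A, c / m := Finset.sum_lt_sum_of_nonempty hne h
      _ = A.card * (c / m) := by rw [Finset.sum_const, nsmul_eq_mul]
      _ ≤ m * (c / m) := by gcongr
      _ = c := by field_simp

/-- On any finite menu of sizes containing `0`, some bundle maximizes the buyer's utility. -/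
theorem exists_bundle_max_utility {α : Type*} [Fintype α]
    (v : Finset α → ℝ) (π : ℕ → ℝ) {Q : Finset ℕ} (h0 : 0 ∈ Q) :
    ∃ S : Finset α, S.card ∈ Q ∧
      ∀ q ∈ Q, ∀ T : Finset α, T.card = q → v T - π q ≤ v S - π S.card := by
  obtain ⟨S, hS, hmax⟩ := Finset.exists_max_image
    (Finset.univ.filter fun S : Finset α => S.card ∈ Q) (fun S => v S - π S.card)
    ⟨∅, by simpa using h0⟩
  refine ⟨S, (Finset.mem_filter.1 hS).2, ?_⟩
  rintro q hq T rfl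
  exact hmax T (Finset.mem_filter.2 ⟨Finset.mem_univ T, hq⟩)

/-- Removing from a bundle-size pricing menu all sizes below the smallest
size `d` whose expected revenue contribution is at least `(ε/m)·Rev` loses at most an
`ε` fraction of the expected revenue. -/
theorem delete_small_bundles_preserves_revenue
    {α ι : Type*} [Fintype α] [DecidableEq α] [Fintype ι] [DecidableEq ι]
    (m : ℕ) (hcard : Fintype.card α = m)
    (prob : ι → ℝ) (hprob0 : ∀ i, 0 ≤ prob i) (hprob1 : ∑ i, prob i = 1)
    (vals : ι → Finset α → ℝ)
    (hmono : ∀ i, ∀ S T : Finset α, S ⊆ T → vals i S ≤ vals i T)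
    (hnn : ∀ i (S : Finset α), 0 ≤ vals i S) (h0 : ∀ i, vals i ∅ = 0)
    (Q : Finset ℕ) (π : ℕ → ℝ) (hmenu : IsBSPMenu m Q π)
    (σ : ι → ℕ)
    (hσ : ∀ i, 0 < prob i → σ i ∈ Q ∧ ∃ S : Finset α, S.card = σ i ∧
      ∀ q ∈ Q, ∀ T : Finset α, T.card = q → vals i T - π q ≤ vals i S - π (σ i))
    (ε : ℝ) (hε0 : 0 < ε) (hε1 : ε ≤ 1)
    (hRev : 0 < ∑ i, prob i * π (σ i)) :
    ∃ d ∈ Q,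
      ((ε / m) * (∑ i, prob i * π (σ i)) ≤
        π d * ∑ i ∈ Finset.univ.filter (fun i => σ i = d), prob i) ∧
      (∀ d' ∈ Q, d' < d →
        ¬ ((ε / m) * (∑ i, prob i * π (σ i)) ≤
          π d' * ∑ i ∈ Finset.univ.filter (fun i => σ i = d'), prob i)) ∧
      ∃ σ₂ : ι → ℕ,
        (∀ i, 0 < prob i →
          σ₂ i ∈ insert 0 (Q.filter (fun q => d ≤ q)) ∧
          ∃ S : Finset α, S.card = σ₂ i ∧
            ∀ q ∈ insert 0 (Q.filter (fun q => d ≤ q)), ∀ T : Finset α,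
              T.card = q → vals i T - π q ≤ vals i S - π (σ₂ i)) ∧
        (1 - ε) * (∑ i, prob i * π (σ i)) ≤ ∑ i, prob i * π (σ₂ i) := by
  obtain ⟨hQ0, hQm, hπ0, hπnn, -⟩ := hmenu
  set R := ∑ i, prob i * π (σ i)
  have hm : 0 < m := by
    rcases Nat.eq_zero_or_pos m with rfl | h
    · refine absurd hRev (not_lt.2 (Finset.sum_nonpos fun i _ => ?_))
      rcases (hprob0 i).eq_or_lt with hi | hi
      · simp [← hi]
      · have : σ i = 0 := Nat.le_zero.1 (hQm _ (hσ i hi).1)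
        simp [this, hπ0]
    · exact h
  have hm' : (0 : ℝ) < m := by exact_mod_cast hm
  have hεR : 0 < ε * R := mul_pos hε0 hRev
  have hex : ∃ d, d ∈ Q ∧ (ε / m) * R ≤
      π d * ∑ i ∈ Finset.univ.filter (fun i => σ i = d), prob i := by
    by_contra! hno
    have hlt := sum_revenue_ite_mem_lt hm prob π σ (A := Q.erase 0)
      (fun q hq => Finset.mem_Icc.2 ⟨Nat.pos_of_ne_zero (Finset.ne_of_mem_erase hq),
        hQm q (Finset.mem_of_mem_erase hq)⟩) hεR
      (fun q hq => by
        rw [mul_div_right_comm]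
        exact hno q (Finset.mem_of_mem_erase hq))
    have hle : R ≤ ∑ i, (if σ i ∈ Q.erase 0 then prob i * π (σ i) else 0) := by
      refine Finset.sum_le_sum fun i _ => ?_
      split_ifs with h
      · exact le_rfl
      · rcases (hprob0 i).eq_or_lt with hi | hi
        · simp [← hi]
        · have : σ i = 0 := by
            by_contra hne
            exact h (Finset.mem_erase.2 ⟨hne, (hσ i hi).1⟩)
          simp [this, hπ0]
    nlinarith
  classical
  obtain ⟨hdQ, hd⟩ := Nat.find_spec hex
  have hmin : ∀ d' ∈ Q, d' < Nat.find hex → ¬ ((ε / m) * R ≤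
      π d' * ∑ i ∈ Finset.univ.filter (fun i => σ i = d'), prob i) :=
    fun d' hd' hlt hle => Nat.find_min hex hlt ⟨hd', hle⟩
  generalize Nat.find hex = d at hdQ hd hmin
  refine ⟨d, hdQ, hd, hmin, ?_⟩
  set Q₂ := insert 0 (Q.filter (fun q => d ≤ q))
  have hQ₂Q : Q₂ ⊆ Q := Finset.insert_subset hQ0 (Finset.filter_subset _ _)
  have hsel : ∀ i, ∃ s, s ∈ Q₂ ∧ (0 < prob i → σ i ∈ Q₂ → s = σ i) ∧
      (∃ S : Finset α, S.card = s ∧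
        ∀ q ∈ Q₂, ∀ T : Finset α, T.card = q → vals i T - π q ≤ vals i S - π s) := by
    intro i
    by_cases h : 0 < prob i ∧ σ i ∈ Q₂
    · obtain ⟨-, S, hS, hopt⟩ := hσ i h.1
      exact ⟨σ i, h.2, fun _ _ => rfl, S, hS, fun q hq => hopt q (hQ₂Q hq)⟩
    · obtain ⟨S, hS, hopt⟩ := exists_bundle_max_utility (vals i) π
        (Finset.mem_insert_self 0 (Q.filter (fun q => d ≤ q)))
      exact ⟨S.card, hS, fun h₁ h₂ => absurd ⟨h₁, h₂⟩ h, S, rfl, hopt⟩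
  choose σ₂ hmem hkeep hopt using hsel
  refine ⟨σ₂, fun i _ => ⟨hmem i, hopt i⟩, ?_⟩
  have hlt := sum_revenue_ite_mem_lt hm prob π σ (A := Q.filter (fun q => 0 < q ∧ q < d))
    (fun q hq => by
      obtain ⟨hq, hpos, -⟩ := Finset.mem_filter.1 hq
      exact Finset.mem_Icc.2 ⟨hpos, hQm q hq⟩) hεR
    (fun q hq => by
      obtain ⟨hq, -, hqd⟩ := Finset.mem_filter.1 hq
      rw [mul_div_right_comm]
      exact not_le.1 (hmin q hq hqd))
  have hle : R ≤ ∑ i, (prob i * π (σ₂ i) +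
      if σ i ∈ Q.filter (fun q => 0 < q ∧ q < d) then prob i * π (σ i) else 0) := by
    refine Finset.sum_le_sum fun i _ => ?_
    have hnonneg : 0 ≤ prob i * π (σ₂ i) := mul_nonneg (hprob0 i) (hπnn _ (hQ₂Q (hmem i)))
    split_ifs with h
    · linarith
    · rcases (hprob0 i).eq_or_lt with hi | hi
      · simp [← hi]
      · have : σ i ∈ Q₂ := by
          have hiQ := (hσ i hi).1
          simp only [Finset.mem_filter, hiQ, true_and, not_and, not_lt] at h
          rcases Nat.eq_zero_or_pos (σ i) with hz | hp
          · exact Finset.mem_insert.2 (Or.inl hz)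
          · exact Finset.mem_insert_of_mem (Finset.mem_filter.2 ⟨hiQ, h hp⟩)
        rw [hkeep i hi this, add_zero]
  rw [Finset.sum_add_distrib] at hle
  linarith
end
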